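/- Let (Ω, μ) be a measure space with μ(Ω) < ∞, let V be a finite-dimensional linear subspace of L⁴(μ; ℝ), let a : V × V → ℝ be a symmetric bilinear form with a(v,v) ≥ 0 for all v ∈ V, let w ∈ V, and let k, ε be real numbers with 0 < k < ε². Define G : V → ℝ by G(v) := (k/2) a(v,v) + (k/ε²) ∫_Ω (1/4)(v² − 1)² dμ + (1/2) ∫_Ω v² dμ − ∫_Ω w v dμ. Then G has a unique minimizer over V. -/

import Mathlib

open MeasureTheory

/-- A coercive quartic perturbation of a positive definite quadratic functional on a
finite-dimensional normed space has a unique minimizer. -/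
lemma existsUnique_minimizer_quadratic_add_norm_pow_four {E : Type*} [NormedAddCommGroup E]
    [NormedSpace ℝ E] [FiniteDimensional ℝ E] (q : E →ₗ[ℝ] E →ₗ[ℝ] ℝ)
    (hq : ∀ v, v ≠ 0 → 0 < q v v) (l : E →ₗ[ℝ] ℝ) {c : ℝ} (hc : 0 < c) :
    ∃! u : E, ∀ v : E, q u u + c * ‖u‖ ^ 4 - l u ≤ q v v + c * ‖v‖ ^ 4 - l v := by
  have hq_cont : Continuous fun v => q v v :=
    (q.toContinuousBilinearMap.continuous.clm_apply continuous_id :)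
  have hl_cont : Continuous l := l.continuous_of_finiteDimensional
  have hq_nonneg (v : E) : 0 ≤ q v v := by
    rcases eq_or_ne v 0 with rfl | hv
    · simp
    · exact (hq v hv).le
  have : ProperSpace E := FiniteDimensional.proper_real E
  apply existsUnique_of_exists_of_unique
  · have hcont : Continuous fun v : E => q v v + c * ‖v‖ ^ 4 - l v :=
      (hq_cont.add ((continuous_norm.pow 4).const_mul c)).sub hl_cont
    apply hcont.exists_forall_le
    set M := ‖l.toContinuousLinearMap‖
    have hpoly : Filter.Tendsto (fun t : ℝ => t * (c * t ^ 3 - M)) Filter.atTop Filter.atTop := by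
      refine Filter.tendsto_id.atTop_mul_atTop₀ ?_
      exact Filter.tendsto_atTop_add_const_right _ (-M)
        ((Filter.tendsto_pow_atTop (by norm_num)).const_mul_atTop hc)
    refine Filter.tendsto_atTop_mono (fun v => ?_)
      (hpoly.comp (tendsto_norm_cocompact_atTop (E := E)))
    have h1 : |l v| ≤ M * ‖v‖ := l.toContinuousLinearMap.le_opNorm v
    have h2 := le_abs_self (l v)
    have h3 := hq_nonneg v
    simp only [Function.comp_apply]
    linarith
  · intro u v hu hv
    by_contra huv
    have hpos := hq (u - v) (sub_ne_zero.mpr huv)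
    have hmid := hu ((1 / 2 : ℝ) • (u + v))
    have hmid' := hv u
    have hnorm : ‖(1 / 2 : ℝ) • (u + v)‖ ≤ (‖u‖ + ‖v‖) / 2 := by
      rw [norm_smul]
      have := norm_add_le u v
      norm_num
      linarith
    have hpow : ‖(1 / 2 : ℝ) • (u + v)‖ ^ 4 ≤ (‖u‖ ^ 4 + ‖v‖ ^ 4) / 2 := by
      refine (pow_le_pow_left₀ (norm_nonneg _) hnorm 4).trans ?_
      have h1 : ((‖u‖ + ‖v‖) / 2) ^ 2 ≤ (‖u‖ ^ 2 + ‖v‖ ^ 2) / 2 := by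
        nlinarith [sq_nonneg (‖u‖ - ‖v‖)]
      have h2 := pow_le_pow_left₀ (sq_nonneg _) h1 2
      nlinarith [sq_nonneg (‖u‖ ^ 2 - ‖v‖ ^ 2)]
    have hcpow := mul_le_mul_of_nonneg_left hpow hc.le
    simp only [map_add, map_sub, map_smul, LinearMap.add_apply, LinearMap.sub_apply,
      LinearMap.smul_apply, smul_eq_mul] at hpos hmid
    linarith

section LpFour

variable {α : Type*} [MeasurableSpace α] {μ : Measure α}

instance fact_one_le_four_ennreal : Fact ((1 : ENNReal) ≤ 4) := ⟨by norm_num⟩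

lemma integral_pow_four_eq_norm_pow_four (f : Lp ℝ 4 μ) : ∫ x, f x ^ 4 ∂μ = ‖f‖ ^ 4 := by
  have hnonneg : 0 ≤ ∫ x, f x ^ 4 ∂μ := integral_nonneg fun x => by positivity
  rw [Lp.norm_def, (Lp.memLp f).eLpNorm_eq_integral_rpow_norm (by norm_num) (by norm_num)]
  have h4 : (4 : ENNReal).toReal = (4 : ℕ) := by norm_num
  simp only [h4, Real.rpow_natCast, Real.norm_eq_abs, Even.pow_abs (by decide : Even 4)]
  rw [ENNReal.toReal_ofReal (by positivity), Real.rpow_inv_natCast_pow hnonneg (by norm_num)]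

lemma integrable_pow_four (f : Lp ℝ 4 μ) : Integrable (fun x => f x ^ 4) μ := by
  have h := (Lp.memLp f).integrable_norm_pow (p := 4) (by norm_num)
  simpa only [Real.norm_eq_abs, Even.pow_abs (by decide : Even 4)] using h

variable [IsFiniteMeasure μ]

lemma integrable_mul_of_Lp_four (f g : Lp ℝ 4 μ) : Integrable (fun x => f x * g x) μ := by
  have h (f : Lp ℝ 4 μ) : MemLp f 2 μ := (Lp.memLp f).mono_exponent (by norm_num)
  exact (h f).integrable_mul (h g)

/-- The `L²` pairing on `L⁴` of a finite measure. -/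
noncomputable def LpFourPairing (μ : Measure α) [IsFiniteMeasure μ] :
    Lp ℝ 4 μ →ₗ[ℝ] Lp ℝ 4 μ →ₗ[ℝ] ℝ :=
  LinearMap.mk₂ ℝ (fun f g => ∫ x, f x * g x ∂μ)
    (fun f₁ f₂ g => by
      rw [← integral_add (integrable_mul_of_Lp_four f₁ g) (integrable_mul_of_Lp_four f₂ g)]
      refine integral_congr_ae ?_
      filter_upwards [Lp.coeFn_add f₁ f₂] with x hx
      rw [hx, Pi.add_apply, add_mul])
    (fun c f g => by
      rw [smul_eq_mul, ← integral_const_mul]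
      refine integral_congr_ae ?_
      filter_upwards [Lp.coeFn_smul c f] with x hx
      rw [hx, Pi.smul_apply, smul_eq_mul, mul_assoc])
    (fun f g₁ g₂ => by
      rw [← integral_add (integrable_mul_of_Lp_four f g₁) (integrable_mul_of_Lp_four f g₂)]
      refine integral_congr_ae ?_
      filter_upwards [Lp.coeFn_add g₁ g₂] with x hx
      rw [hx, Pi.add_apply, mul_add])
    (fun c f g => by
      rw [smul_eq_mul, ← integral_const_mul]
      refine integral_congr_ae ?_
      filter_upwards [Lp.coeFn_smul c g] with x hx
      rw [hx, Pi.smul_apply, smul_eq_mul, mul_left_comm])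

lemma LpFourPairing_apply (f g : Lp ℝ 4 μ) : LpFourPairing μ f g = ∫ x, f x * g x ∂μ := rfl

lemma LpFourPairing_self_pos {f : Lp ℝ 4 μ} (hf : f ≠ 0) : 0 < LpFourPairing μ f f := by
  refine lt_of_le_of_ne (integral_nonneg fun x => mul_self_nonneg _) fun h => hf ?_
  have h0 := (integral_eq_zero_iff_of_nonneg (fun x => mul_self_nonneg (f x))
    (integrable_mul_of_Lp_four f f)).mp h.symm
  refine (Lp.eq_zero_iff_ae_eq_zero).mpr ?_
  filter_upwards [h0] with x hx
  exact mul_self_eq_zero.mp hx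

lemma integral_double_well (f : Lp ℝ 4 μ) :
    ∫ x, (1 / 4) * (f x ^ 2 - 1) ^ 2 ∂μ
      = (1 / 4) * ‖f‖ ^ 4 - (1 / 2) * LpFourPairing μ f f + (1 / 4) * μ.real Set.univ := by
  have h4 := (integrable_pow_four f).const_mul (1 / 4)
  have h2 := (integrable_mul_of_Lp_four f f).const_mul (1 / 2)
  calc ∫ x, (1 / 4) * (f x ^ 2 - 1) ^ 2 ∂μ
      = ∫ x, ((1 / 4) * f x ^ 4 - (1 / 2) * (f x * f x) + 1 / 4) ∂μ := by
        congr 1 with x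
        ring
    _ = _ := by
        rw [integral_add (by exact h4.sub h2) (integrable_const _), integral_sub h4 h2,
          integral_const_mul, integral_const_mul, integral_pow_four_eq_norm_pow_four,
          integral_const, smul_eq_mul, LpFourPairing_apply, mul_comm (μ.real _)]

end LpFour

/-- Conditional well-posedness of one time step of the fully implicit IP-DG
scheme (`f^{m+1} = (u^{m+1})³ − u^{m+1}`): under the time-step restriction
`0 < k < ε²`, the functional `G` has a unique minimizer over the
finite-dimensional discrete space `V`. -/
theorem fully_implicit_step_wellposed
    {α : Type*} [MeasurableSpace α] (μ : Measure α) [IsFiniteMeasure μ]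
    (V : Submodule ℝ (Lp ℝ 4 μ)) [FiniteDimensional ℝ V]
    (a : V →ₗ[ℝ] V →ₗ[ℝ] ℝ)
    (ha_symm : ∀ v w : V, a v w = a w v)
    (ha_nonneg : ∀ v : V, 0 ≤ a v v)
    (w : V) (k ε : ℝ) (hk : 0 < k) (hkε : k < ε ^ 2) :
    ∃! v₀ : V,
      ∀ v : V,
        (k / 2) * a v₀ v₀
            + (k / ε ^ 2) * ∫ x, (1 / 4) * (((v₀ : Lp ℝ 4 μ) : α → ℝ) x ^ 2 - 1) ^ 2 ∂μ
            + (1 / 2) * ∫ x, ((v₀ : Lp ℝ 4 μ) : α → ℝ) x ^ 2 ∂μ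
            - ∫ x, ((w : Lp ℝ 4 μ) : α → ℝ) x * ((v₀ : Lp ℝ 4 μ) : α → ℝ) x ∂μ
        ≤ (k / 2) * a v v
            + (k / ε ^ 2) * ∫ x, (1 / 4) * (((v : Lp ℝ 4 μ) : α → ℝ) x ^ 2 - 1) ^ 2 ∂μ
            + (1 / 2) * ∫ x, ((v : Lp ℝ 4 μ) : α → ℝ) x ^ 2 ∂μ
            - ∫ x, ((w : Lp ℝ 4 μ) : α → ℝ) x * ((v : Lp ℝ 4 μ) : α → ℝ) x ∂μ := by

  have hε : 0 < ε ^ 2 := hk.trans hkε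
  have hc : 0 < k / ε ^ 2 := div_pos hk hε
  have hc1 : k / ε ^ 2 < 1 := (div_lt_one hε).mpr hkε
  set c := k / ε ^ 2
  let b : V →ₗ[ℝ] V →ₗ[ℝ] ℝ := (LpFourPairing μ).domRestrict₁₂ V V
  let q : V →ₗ[ℝ] V →ₗ[ℝ] ℝ := (k / 2) • a + ((1 - c) / 2) • b
  have hq (v : V) (hv : v ≠ 0) : 0 < q v v :=
    add_pos_of_nonneg_of_pos (mul_nonneg (by positivity) (ha_nonneg v))
      (mul_pos (by linarith) (LpFourPairing_self_pos (by simpa using hv)))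
  have hG (v : V) :
      (k / 2) * a v v + c * ∫ x, (1 / 4) * ((v : Lp ℝ 4 μ) x ^ 2 - 1) ^ 2 ∂μ
          + (1 / 2) * ∫ x, (v : Lp ℝ 4 μ) x ^ 2 ∂μ - ∫ x, (w : Lp ℝ 4 μ) x * (v : Lp ℝ 4 μ) x ∂μ
        = q v v + c / 4 * ‖v‖ ^ 4 - b w v + c / 4 * μ.real Set.univ := by
    have hqv : q v v = (k / 2) * a v v + ((1 - c) / 2) * LpFourPairing μ v v := rfl
    have hbw : b w v = ∫ x, (w : Lp ℝ 4 μ) x * (v : Lp ℝ 4 μ) x ∂μ := rfl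
    have hsq : ∫ x, (v : Lp ℝ 4 μ) x ^ 2 ∂μ = LpFourPairing μ v v := by
      simp only [LpFourPairing_apply, sq]
    rw [integral_double_well, hqv, hbw, hsq, Submodule.coe_norm]
    ring
  simpa only [hG, add_le_add_iff_right] using
    existsUnique_minimizer_quadratic_add_norm_pow_four q hq (b w) (c := c / 4) (by positivity)
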